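/- Let (Φ, ω): (V, E) → (V', E') be a Dirac morphism of linear Dirac spaces, F' a Lagrangian complement to E' in 𝕍', φ ∈ ∧V* a pure spinor defining E, ψ' ∈ ∧(V')* a pure spinor defining F', and set ψ = e^ω ∧ Φ*ψ'. Then ψ ≠ 0 and is a pure spinor defining the backward image F of F'; and the following are equivalent: (a) (Φ, ω) is a strong Dirac morphism (ker(Φ,ω) ∩ E = 0); (b) F is transverse to E; (c) the top-degree pairing (φᵀ ∧ ψ)^[top] ∈ det(V*) is nonzero. -/

import Mathlib

set_option synthInstance.maxHeartbeats 1000000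
set_option maxHeartbeats 1000000

open ExteriorAlgebra CliffordAlgebra Module

/-- Clifford action of `V ⊕ V*` on `∧ V*`. -/
noncomputable def cliffordRho {K V : Type*} [Field K] [AddCommGroup V] [Module K V]
    (w : V × Module.Dual K V) (φ : ExteriorAlgebra K (Module.Dual K V)) :
    ExteriorAlgebra K (Module.Dual K V) :=
  CliffordAlgebra.contractLeft (Module.Dual.eval K V w.1) φ + ExteriorAlgebra.ι K w.2 * φ

/-- The reversal anti-automorphism `ᵀ` of `∧ V*`. -/
noncomputable def revE {K V : Type*} [Field K] [AddCommGroup V] [Module K V]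
    (x : ExteriorAlgebra K (Module.Dual K V)) : ExteriorAlgebra K (Module.Dual K V) :=
  CliffordAlgebra.reverse (Q := (0 : QuadraticForm K (Module.Dual K V))) x

/-- Truncated exponential in an algebra, valid for nilpotent arguments of index `≤ n`. -/
noncomputable def expA {K A : Type*} [Field K] [Ring A] [Algebra K A] (n : ℕ) (a : A) : A :=
  ∑ k ∈ Finset.range (n + 1), (k.factorial : K)⁻¹ • a ^ k

/-- The pullback algebra homomorphism `Φ* : ∧ (V')* → ∧ V*` induced by `Φ : V → V'`. -/
noncomputable def extPullback {K V V' : Type*} [Field K] [AddCommGroup V] [Module K V]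
    [AddCommGroup V'] [Module K V'] (Φ : V →ₗ[K] V') :
    ExteriorAlgebra K (Module.Dual K V') →ₐ[K] ExteriorAlgebra K (Module.Dual K V) :=
  ExteriorAlgebra.lift K
    ⟨(ExteriorAlgebra.ι K).comp Φ.dualMap, fun _ => ExteriorAlgebra.ι_sq_zero _⟩

/-- The relation `w ~_{(Φ,ω)} w'` with the 2-form `ω ∈ ∧²V*` an exterior algebra element. -/
noncomputable def morphRelE {K V V' : Type*} [Field K] [AddCommGroup V] [Module K V]
    [AddCommGroup V'] [Module K V'] (Φ : V →ₗ[K] V')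
    (ω : ExteriorAlgebra K (Module.Dual K V))
    (w : V × Module.Dual K V) (w' : V' × Module.Dual K V') : Prop :=
  Φ w.1 = w'.1 ∧
    ExteriorAlgebra.ι K (w'.2.comp Φ) =
      ExteriorAlgebra.ι K w.2 + CliffordAlgebra.contractLeft (Module.Dual.eval K V w.1) ω

section helpers
variable {K V : Type*} [Field K] [AddCommGroup V] [Module K V]

/-- Contraction by a vector. -/
noncomputable def ctr (v : V) :
    ExteriorAlgebra K (Module.Dual K V) →ₗ[K] ExteriorAlgebra K (Module.Dual K V) :=
  CliffordAlgebra.contractLeft (Module.Dual.eval K V v)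

theorem ctr_def (v : V) (x : ExteriorAlgebra K (Module.Dual K V)) :
    CliffordAlgebra.contractLeft (Module.Dual.eval K V v) x = ctr v x := rfl

theorem ctr_ι_mul (v : V) (a : Module.Dual K V) (x : ExteriorAlgebra K (Module.Dual K V)) :
    ctr v (ExteriorAlgebra.ι K a * x) = a v • x - ExteriorAlgebra.ι K a * ctr v x :=
  CliffordAlgebra.contractLeft_ι_mul _ _ _

theorem ctr_ι (v : V) (a : Module.Dual K V) :
    ctr v (ExteriorAlgebra.ι K a) = algebraMap K _ (a v) :=
  CliffordAlgebra.contractLeft_ι _ _ _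

theorem ctr_algebraMap (v : V) (r : K) :
    ctr v (algebraMap K (ExteriorAlgebra K (Module.Dual K V)) r) = 0 :=
  CliffordAlgebra.contractLeft_algebraMap _ _ _

theorem ctr_comm (v u : V) (x : ExteriorAlgebra K (Module.Dual K V)) :
    ctr v (ctr u x) = - ctr u (ctr v x) :=
  CliffordAlgebra.contractLeft_comm _ _ _

theorem ctr_add_left (v u : V) (x : ExteriorAlgebra K (Module.Dual K V)) :
    ctr (v + u) x = ctr v x + ctr u x := by
  simp [ctr]

theorem ctr_smul_left (c : K) (v : V) (x : ExteriorAlgebra K (Module.Dual K V)) :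
    ctr (c • v) x = c • ctr v x := by
  simp [ctr]

theorem ext_ind {P : ExteriorAlgebra K (Module.Dual K V) → Prop}
    (h0 : ∀ r : K, P (algebraMap _ _ r))
    (h1 : ∀ x y, P x → P y → P (x + y))
    (h2 : ∀ x m, P x → P (ExteriorAlgebra.ι K m * x)) : ∀ x, P x :=
  CliffordAlgebra.left_induction _ h0 h1 h2

theorem ι_anti (a b : Module.Dual K V) :
    ExteriorAlgebra.ι K a * ExteriorAlgebra.ι K b
      = - (ExteriorAlgebra.ι K b * ExteriorAlgebra.ι K a) :=
  eq_neg_of_add_eq_zero_left (ExteriorAlgebra.ι_add_mul_swap a b)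

theorem cliffordRho_eq (w : V × Module.Dual K V) (x : ExteriorAlgebra K (Module.Dual K V)) :
    cliffordRho w x = ctr w.1 x + ExteriorAlgebra.ι K w.2 * x := rfl

/-- The Clifford action, as a bilinear map. -/
noncomputable def rhoL : (V × Module.Dual K V) →ₗ[K]
    ExteriorAlgebra K (Module.Dual K V) →ₗ[K] ExteriorAlgebra K (Module.Dual K V) :=
  LinearMap.mk₂ K cliffordRho
    (by intro a b x; simp [cliffordRho_eq, ctr_add_left, add_mul]; abel)
    (by intro c a x; simp [cliffordRho_eq, ctr_smul_left])
    (by intro a x y; simp [cliffordRho_eq, mul_add]; abel)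
    (by intro c a x; simp [cliffordRho_eq])

theorem rhoL_apply (w : V × Module.Dual K V) (x : ExteriorAlgebra K (Module.Dual K V)) :
    rhoL w x = ctr w.1 x + ExteriorAlgebra.ι K w.2 * x := rfl

theorem rhoL_comm (w u : V × Module.Dual K V) (x : ExteriorAlgebra K (Module.Dual K V)) :
    rhoL w (rhoL u x) = (w.2 u.1 + u.2 w.1) • x - rhoL u (rhoL w x) := by
  simp only [rhoL_apply, map_add, ctr_ι_mul, add_smul]
  rw [ctr_comm w.1 u.1, ← mul_assoc, ← mul_assoc, ι_anti w.2 u.2, neg_mul]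
  abel

theorem ep_zero : (⋀[K]^0 (Module.Dual K V)) = 1 := pow_zero _

theorem ep_one : (⋀[K]^1 (Module.Dual K V)) = LinearMap.range (ExteriorAlgebra.ι K) := pow_one _

theorem ep_succ (k : ℕ) : (⋀[K]^(k + 1) (Module.Dual K V)) =
    LinearMap.range (ExteriorAlgebra.ι K) * (⋀[K]^k (Module.Dual K V)) := pow_succ' _ _

/-- degree lowering -/
theorem ctr_mem (v : V) (k : ℕ) (x : ExteriorAlgebra K (Module.Dual K V))
    (hx : x ∈ (⋀[K]^(k + 1) (Module.Dual K V))) : ctr v x ∈ (⋀[K]^k (Module.Dual K V)) := by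
  induction k generalizing x with
  | zero =>
    rw [zero_add, ep_one] at hx
    obtain ⟨a, rfl⟩ := hx
    rw [ctr_ι, ep_zero]
    exact Submodule.mem_one.2 ⟨_, rfl⟩
  | succ k ih =>
    rw [ep_succ] at hx
    induction hx using Submodule.mul_induction_on' with
    | mem_mul_mem m hm n hn =>
      obtain ⟨a, rfl⟩ := hm
      rw [ctr_ι_mul]
      refine Submodule.sub_mem _ (Submodule.smul_mem _ _ hn) ?_
      rw [ep_succ]
      exact Submodule.mul_mem_mul ⟨a, rfl⟩ (ih n hn)
    | add x _ y _ hx hy => rw [map_add]; exact Submodule.add_mem _ hx hy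

theorem ctr_zero_deg (v : V) (x : ExteriorAlgebra K (Module.Dual K V))
    (hx : x ∈ (⋀[K]^0 (Module.Dual K V))) : ctr v x = 0 := by
  rw [ep_zero] at hx
  obtain ⟨r, rfl⟩ := Submodule.mem_one.1 hx
  exact ctr_algebraMap _ _

/-- component projection -/
noncomputable def pr (k : ℕ) :
    ExteriorAlgebra K (Module.Dual K V) →ₗ[K] ExteriorAlgebra K (Module.Dual K V) :=
  GradedAlgebra.proj (fun i : ℕ => ⋀[K]^i (Module.Dual K V)) k

theorem pr_same {k : ℕ} {x : ExteriorAlgebra K (Module.Dual K V)}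
    (hx : x ∈ (⋀[K]^k (Module.Dual K V))) : pr k x = x := by
  rw [pr, GradedAlgebra.proj_apply]
  exact DirectSum.decompose_of_mem_same (fun i : ℕ => ⋀[K]^i (Module.Dual K V)) hx

theorem pr_ne {j k : ℕ} {x : ExteriorAlgebra K (Module.Dual K V)}
    (hx : x ∈ (⋀[K]^j (Module.Dual K V))) (h : j ≠ k) : pr k x = 0 := by
  rw [pr, GradedAlgebra.proj_apply]
  exact DirectSum.decompose_of_mem_ne (fun i : ℕ => ⋀[K]^i (Module.Dual K V)) hx h

theorem pr_mem (k : ℕ) (x : ExteriorAlgebra K (Module.Dual K V)) :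
    pr k x ∈ (⋀[K]^k (Module.Dual K V)) := by
  rw [pr, GradedAlgebra.proj_apply]
  exact SetLike.coe_mem _

theorem graded_ind {P : ExteriorAlgebra K (Module.Dual K V) → Prop}
    (h0 : P 0)
    (h1 : ∀ k x, x ∈ (⋀[K]^k (Module.Dual K V)) → P x)
    (h2 : ∀ x y, P x → P y → P (x + y)) : ∀ x, P x :=
  DirectSum.Decomposition.inductionOn (fun i : ℕ => ⋀[K]^i (Module.Dual K V)) h0
    (fun {i} m => h1 i m m.2) h2

theorem pr_ctr (v : V) (k : ℕ) (x : ExteriorAlgebra K (Module.Dual K V)) :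
    pr k (ctr v x) = ctr v (pr (k + 1) x) := by
  induction x using graded_ind with
  | h0 => simp
  | h2 x y hx hy => simp [hx, hy]
  | h1 j x hx =>
    rcases j with _ | j
    · rw [ctr_zero_deg v x hx, pr_ne hx (by omega)]; simp
    · by_cases h : j = k
      · subst h
        rw [pr_same hx, pr_same (ctr_mem v _ x hx)]
      · rw [pr_ne hx (by omega), pr_ne (ctr_mem v _ x hx) h]; simp

theorem eq_zero_of_pr (x : ExteriorAlgebra K (Module.Dual K V)) (h : ∀ k, pr k x = 0) :
    x = 0 := by
  apply (DirectSum.decompose (fun i : ℕ => ⋀[K]^i (Module.Dual K V))).injective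
  rw [DirectSum.decompose_zero]
  ext k
  have := h k
  rw [pr, GradedAlgebra.proj_apply] at this
  simpa using this

theorem numOp [FiniteDimensional K V] (k : ℕ) (x : ExteriorAlgebra K (Module.Dual K V))
    (hx : x ∈ (⋀[K]^k (Module.Dual K V))) :
    ∑ i, ExteriorAlgebra.ι K ((Module.finBasis K V).coord i) * ctr (Module.finBasis K V i) x
      = (k : K) • x := by
  induction k generalizing x with
  | zero => simp [ctr_zero_deg _ x hx]
  | succ k ih =>
    rw [ep_succ] at hx
    induction hx using Submodule.mul_induction_on' with
    | mem_mul_mem m hm n hn =>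
      obtain ⟨a, rfl⟩ := hm
      simp only [ctr_ι_mul, mul_sub, Finset.sum_sub_distrib]
      have h1 : ∑ i, ExteriorAlgebra.ι K ((Module.finBasis K V).coord i) *
          (a (Module.finBasis K V i) • n) = ExteriorAlgebra.ι K a * n := by
        have : a = ∑ i, a (Module.finBasis K V i) • (Module.finBasis K V).coord i := by
          refine (Module.finBasis K V).ext fun j => ?_
          simp
        conv_rhs => rw [this]
        simp only [map_sum, map_smul, Finset.sum_mul, smul_mul_assoc, mul_smul_comm]
      have h2 : ∑ i, ExteriorAlgebra.ι K ((Module.finBasis K V).coord i) *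
          (ExteriorAlgebra.ι K a * ctr (Module.finBasis K V i) n)
          = - (ExteriorAlgebra.ι K a * ((k : K) • n)) := by
        rw [← ih n hn, Finset.mul_sum, ← Finset.sum_neg_distrib]
        refine Finset.sum_congr rfl fun i _ => ?_
        rw [← mul_assoc, ι_anti, neg_mul, mul_assoc]
      rw [h1, h2]
      push_cast
      rw [add_smul, one_smul, mul_smul_comm]; abel
    | add x _ y _ hx hy => 
      simp only [map_add, mul_add, Finset.sum_add_distrib, smul_add, hx, hy]

theorem scalar_of_ctr [CharZero K] [FiniteDimensional K V]
    (x : ExteriorAlgebra K (Module.Dual K V))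
    (h : ∀ v, ctr v x = 0) : ∃ r : K, x = algebraMap K _ r := by
  have h1 : ∀ k, pr (k + 1) x = 0 := by
    intro k
    have h2 : ∀ v, ctr v (pr (k + 1) x) = 0 := fun v => by rw [← pr_ctr, h v, map_zero]
    have h3 := numOp (k + 1) _ (pr_mem (k + 1) x)
    simp only [h2, mul_zero, Finset.sum_const_zero] at h3
    rcases smul_eq_zero.1 h3.symm with h4 | h4
    · exact absurd h4 (by exact_mod_cast Nat.succ_ne_zero k)
    · exact h4
  have h0 : x = pr 0 x := by
    rw [← sub_eq_zero]
    apply eq_zero_of_pr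
    rintro (_ | k)
    · rw [map_sub, pr_same (pr_mem 0 x), sub_self]
    · rw [map_sub, h1, pr_ne (pr_mem 0 x) (by omega), sub_self]
  have h5 := pr_mem 0 x
  rw [← h0, ep_zero] at h5
  obtain ⟨r, hr⟩ := Submodule.mem_one.1 h5
  exact ⟨r, hr.symm⟩

theorem deg_top [FiniteDimensional K V] {k : ℕ} (hk : finrank K V < k)
    (x : ExteriorAlgebra K (Module.Dual K V))
    (hx : x ∈ (⋀[K]^k (Module.Dual K V))) : x = 0 := by
  have h := exteriorPower.finrank_eq K k (M := Module.Dual K V)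
  rw [Subspace.dual_finrank_eq, Nat.choose_eq_zero_of_lt hk] at h
  have h2 : (⋀[K]^k (Module.Dual K V)) = ⊥ := Submodule.finrank_eq_zero.1 h
  rw [h2] at hx
  simpa using hx

theorem exists_top [FiniteDimensional K V] :
    ∃ x : ExteriorAlgebra K (Module.Dual K V), pr (finrank K V) x ≠ 0 := by
  have h := exteriorPower.finrank_eq K (finrank K V) (M := Module.Dual K V)
  rw [Subspace.dual_finrank_eq, Nat.choose_self] at h
  by_contra! hc
  have h2 : (⋀[K]^(finrank K V) (Module.Dual K V)) = ⊥ := by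
    rw [eq_bot_iff]
    intro x hx
    have := hc x
    rw [pr_same hx] at this
    simpa using this
  rw [h2] at h
  simp at h

theorem irred [CharZero K] [FiniteDimensional K V]
    (T : Submodule K (ExteriorAlgebra K (Module.Dual K V)))
    (hT : ∀ w, ∀ x ∈ T, rhoL w x ∈ T) (x) (hx : x ∈ T) (hx0 : x ≠ 0) : T = ⊤ := by
  have hc : ∀ v, ∀ x ∈ T, ctr v x ∈ T := fun v x hx => by
    simpa [rhoL_apply] using hT (v, 0) x hx
  have hm : ∀ a, ∀ x ∈ T, ExteriorAlgebra.ι K a * x ∈ T := fun a x hx => by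
    have h := hT (0, a) x hx
    have h0 : ctr (0 : V) x = 0 := by simp [ctr]
    simpa [rhoL_apply, h0] using h
  have key : ∀ d, ∀ x ∈ T, x ≠ 0 → (∀ k, d ≤ k → pr k x = 0) →
      (1 : ExteriorAlgebra K (Module.Dual K V)) ∈ T := by
    intro d
    induction d with
    | zero => intro x _ h0 h; exact absurd (eq_zero_of_pr x fun k => h k (Nat.zero_le _)) h0
    | succ d ih =>
      intro x hx h0 h
      by_cases hv : ∀ v, ctr v x = 0
      · obtain ⟨r, rfl⟩ := scalar_of_ctr x hv
        have hr : r ≠ 0 := by rintro rfl; simp at h0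
        have := T.smul_mem r⁻¹ hx
        rwa [Algebra.algebraMap_eq_smul_one, smul_smul, inv_mul_cancel₀ hr, one_smul] at this
      · push Not at hv
        obtain ⟨v, hv⟩ := hv
        refine ih _ (hc v x hx) hv fun k hk => ?_
        rw [pr_ctr, h _ (by omega), map_zero]
  have h1 := key (finrank K V + 1) x hx hx0 fun k hk => deg_top (by omega) _ (pr_mem k x)
  rw [eq_top_iff]
  intro y _
  induction y using ext_ind with
  | h0 r => rw [Algebra.algebraMap_eq_smul_one]; exact T.smul_mem _ h1
  | h1 x y hx hy => exact T.add_mem (hx trivial) (hy trivial)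
  | h2 x m hx => exact hm _ _ (hx trivial)

theorem gen_lemma [CharZero K] [FiniteDimensional K V]
    (ψ : ExteriorAlgebra K (Module.Dual K V)) (hψ : ψ ≠ 0)
    (A : Set (V × Module.Dual K V))
    (hA : ∀ w : V × Module.Dual K V, ∃ a ∈ A, ∃ f, rhoL f ψ = 0 ∧ w = a + f)
    (T : Submodule K (ExteriorAlgebra K (Module.Dual K V)))
    (hψT : ψ ∈ T) (hT : ∀ a ∈ A, ∀ x ∈ T, rhoL a x ∈ T) : T = ⊤ := by
  let M : Submodule K (ExteriorAlgebra K (Module.Dual K V)) :=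
    sInf {N | ψ ∈ N ∧ ∀ a ∈ A, ∀ x ∈ N, rhoL a x ∈ N}
  have hψM : ψ ∈ M := by
    simp only [M, Submodule.mem_sInf]
    exact fun N hN => hN.1
  have hAM : ∀ a ∈ A, ∀ x ∈ M, rhoL a x ∈ M := by
    intro a ha x hx
    simp only [M, Submodule.mem_sInf] at hx ⊢
    exact fun N hN => hN.2 a ha x (hx N hN)
  have hmin : ∀ N : Submodule K (ExteriorAlgebra K (Module.Dual K V)), ψ ∈ N →
      (∀ a ∈ A, ∀ x ∈ N, rhoL a x ∈ N) → M ≤ N := fun N h1 h2 => sInf_le ⟨h1, h2⟩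
  have hFM : ∀ f, rhoL f ψ = 0 → M ≤ M ⊓ M.comap (rhoL f) := by
    intro f hf
    apply hmin
    · exact ⟨hψM, by simp [hf]⟩
    · rintro a ha x ⟨hx1, hx2⟩
      refine ⟨hAM a ha x hx1, ?_⟩
      rw [SetLike.mem_coe, Submodule.mem_comap, rhoL_comm]
      exact M.sub_mem (M.smul_mem _ hx1) (hAM a ha _ hx2)
  have hM : M = ⊤ := by
    refine irred M ?_ ψ hψM hψ
    intro w x hx
    obtain ⟨a, ha, f, hf, rfl⟩ := hA w
    rw [map_add, LinearMap.add_apply]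
    exact M.add_mem (hAM a ha x hx) (hFM f hf hx).2
  rw [eq_top_iff, ← hM]
  exact hmin T hψT hT

/-- Chevalley pairing self-adjointness -/
theorem pair_adj [FiniteDimensional K V] (w : V × Module.Dual K V)
    (x y : ExteriorAlgebra K (Module.Dual K V)) :
    pr (finrank K V) (revE (rhoL w x) * y) = pr (finrank K V) (revE x * rhoL w y) := by
  have radd : ∀ x y : ExteriorAlgebra K (Module.Dual K V), revE (x + y) = revE x + revE y :=
    fun x y => map_add _ _ _
  have rsub : ∀ x y : ExteriorAlgebra K (Module.Dual K V), revE (x - y) = revE x - revE y :=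
    fun x y => map_sub _ _ _
  have rsmul : ∀ (c : K) (y : ExteriorAlgebra K (Module.Dual K V)), revE (c • y) = c • revE y :=
    fun x y => map_smul _ _ _
  have rmul : ∀ (a : Module.Dual K V) (x : ExteriorAlgebra K (Module.Dual K V)),
      revE (ExteriorAlgebra.ι K a * x) = revE x * ExteriorAlgebra.ι K a := by
    intro a x
    unfold revE
    refine (CliffordAlgebra.reverse.map_mul _ _).trans ?_
    congr 1
    exact CliffordAlgebra.reverse_ι _
  have ralg : ∀ r : K, revE (algebraMap K (ExteriorAlgebra K (Module.Dual K V)) r)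
      = algebraMap K _ r := fun r => CliffordAlgebra.reverse.commutes r
  have hc : ∀ (v : V) (x y : ExteriorAlgebra K (Module.Dual K V)),
      pr (finrank K V) (revE (ctr v x) * y) = pr (finrank K V) (revE x * ctr v y) := by
    intro v x
    induction x using ext_ind with
    | h0 r =>
      intro y
      rw [ctr_algebraMap, ralg, ← Algebra.smul_def, map_smul, pr_ctr,
        deg_top (Nat.lt_succ_self _) _ (pr_mem _ y)]
      have : revE (0 : ExteriorAlgebra K (Module.Dual K V)) = 0 := map_zero _
      simp [this]
    | h1 x x' hx hy => intro y; simp only [map_add, radd, add_mul, hx, hy]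
    | h2 x a hx =>
      intro y
      rw [ctr_ι_mul, rsub, rsmul, rmul, rmul, sub_mul, mul_assoc, mul_assoc, map_sub, hx,
        ctr_ι_mul, mul_sub, map_sub, smul_mul_assoc, mul_smul_comm]
      abel
  rw [rhoL_apply, rhoL_apply, radd, add_mul, mul_add, map_add, map_add, hc, rmul, mul_assoc]

end helpers

section helpers2
variable {K V V' : Type*} [Field K] [AddCommGroup V] [Module K V]
  [AddCommGroup V'] [Module K V']

theorem sep_lemma [FiniteDimensional K V] (X : Submodule K (V × Module.Dual K V))
    (w : V × Module.Dual K V)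
    (h : ∀ p : V × Module.Dual K V, (∀ u ∈ X, u.2 p.1 + p.2 u.1 = 0) →
      w.2 p.1 + p.2 w.1 = 0) : w ∈ X := by
  by_contra hw
  obtain ⟨f, hf, hX⟩ := Submodule.exists_le_ker_of_notMem hw
  obtain ⟨v, hv⟩ := (Module.evalEquiv K V).surjective (f.comp (LinearMap.inr K V (Module.Dual K V)))
  have key : ∀ u : V × Module.Dual K V,
      f u = u.2 v + (f.comp (LinearMap.inl K V (Module.Dual K V))) u.1 := by
    intro u
    have h1 := LinearMap.congr_fun hv u.2
    simp only [Module.evalEquiv_apply, LinearMap.comp_apply, LinearMap.inr_apply] at h1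
    have h2 : u.2 v = f (0, u.2) := h1
    rw [h2, LinearMap.comp_apply, LinearMap.inl_apply, ← map_add]
    simp
  apply hf
  rw [key]
  exact h (v, f.comp (LinearMap.inl K V (Module.Dual K V))) fun u hu => by
    rw [← key]; exact hX hu

theorem pull_ι (Φ : V →ₗ[K] V') (a : Module.Dual K V') :
    extPullback Φ (ExteriorAlgebra.ι K a) = ExteriorAlgebra.ι K (a.comp Φ) := by
  simp only [extPullback, ExteriorAlgebra.lift_ι_apply]
  rfl

theorem pull_ctr (Φ : V →ₗ[K] V') (v : V) (x : ExteriorAlgebra K (Module.Dual K V')) :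
    extPullback Φ (ctr (Φ v) x) = ctr v (extPullback Φ x) := by
  induction x using ext_ind with
  | h0 r => rw [ctr_algebraMap, AlgHom.commutes, ctr_algebraMap, map_zero]
  | h1 x y hx hy => simp only [map_add, hx, hy]
  | h2 x a hx =>
    rw [ctr_ι_mul, map_sub, map_mul, map_mul, map_smul, pull_ι, ctr_ι_mul, hx]
    rfl

theorem two_ind {P : ExteriorAlgebra K (Module.Dual K V) → Prop}
    (h1 : ∀ a b, P (ExteriorAlgebra.ι K a * ExteriorAlgebra.ι K b))
    (h2 : ∀ x y, P x → P y → P (x + y))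
    (ω : ExteriorAlgebra K (Module.Dual K V)) (hω : ω ∈ (⋀[K]^2 (Module.Dual K V))) : P ω := by
  rw [ep_succ 1, ep_one] at hω
  refine Submodule.mul_induction_on hω ?_ h2
  rintro _ ⟨a, rfl⟩ _ ⟨b, rfl⟩
  exact h1 a b

theorem two_comm_ι (ω : ExteriorAlgebra K (Module.Dual K V))
    (hω : ω ∈ (⋀[K]^2 (Module.Dual K V))) (c : Module.Dual K V) :
    ω * ExteriorAlgebra.ι K c = ExteriorAlgebra.ι K c * ω := by
  refine two_ind (P := fun ω => ω * ExteriorAlgebra.ι K c = ExteriorAlgebra.ι K c * ω)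
    ?_ ?_ ω hω
  · intro a b
    rw [mul_assoc, ι_anti b c, mul_neg, ← mul_assoc, ι_anti a c, neg_mul, neg_neg, mul_assoc]
  · intro x y hx hy
    simp only [add_mul, mul_add, hx, hy]

theorem two_ctr (v : V) (ω : ExteriorAlgebra K (Module.Dual K V))
    (hω : ω ∈ (⋀[K]^2 (Module.Dual K V))) (x : ExteriorAlgebra K (Module.Dual K V)) :
    ctr v (ω * x) = ctr v ω * x + ω * ctr v x := by
  refine two_ind (P := fun ω => ctr v (ω * x) = ctr v ω * x + ω * ctr v x) ?_ ?_ ω hω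
  · intro a b
    rw [mul_assoc, ctr_ι_mul, ctr_ι_mul, ctr_ι_mul, ctr_ι, mul_sub, sub_mul, smul_mul_assoc,
      ← Algebra.commutes, ← Algebra.smul_def, smul_mul_assoc, mul_smul_comm, mul_assoc]
    abel
  · intro y z hy hz
    simp only [add_mul, map_add, hy, hz]; abel

theorem two_ctr_ι (v : V) (ω : ExteriorAlgebra K (Module.Dual K V))
    (hω : ω ∈ (⋀[K]^2 (Module.Dual K V))) :
    ∃ b : Module.Dual K V, ctr v ω = ExteriorAlgebra.ι K b := by
  have h := ctr_mem v 1 ω hω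
  rw [ep_one] at h
  obtain ⟨b, hb⟩ := h
  exact ⟨b, hb.symm⟩

theorem two_pow_mem (ω : ExteriorAlgebra K (Module.Dual K V))
    (hω : ω ∈ (⋀[K]^2 (Module.Dual K V))) (k : ℕ) :
    ω ^ k ∈ (⋀[K]^(2 * k) (Module.Dual K V)) := by
  have := Submodule.pow_mem_pow _ hω k
  change _ ∈ (LinearMap.range (ExteriorAlgebra.ι K)) ^ (2 * k)
  rw [pow_mul]
  exact this

theorem pow_ctr (v : V) (ω : ExteriorAlgebra K (Module.Dual K V))
    (hω : ω ∈ (⋀[K]^2 (Module.Dual K V))) (b : Module.Dual K V)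
    (hb : ctr v ω = ExteriorAlgebra.ι K b)
    (x : ExteriorAlgebra K (Module.Dual K V)) (k : ℕ) :
    ctr v (ω ^ k * x) = (k : K) • (ω ^ (k - 1) * (ExteriorAlgebra.ι K b * x))
      + ω ^ k * ctr v x := by
  induction k with
  | zero => simp
  | succ k ih =>
    rw [pow_succ', mul_assoc, two_ctr v ω hω, ih, hb, mul_add, ← mul_assoc ω, ← add_assoc]
    congr 1
    have hc : ExteriorAlgebra.ι K b * (ω ^ k * x) = ω ^ k * (ExteriorAlgebra.ι K b * x) := by
      have : Commute ω (ExteriorAlgebra.ι K b) := two_comm_ι ω hω b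
      rw [← mul_assoc, ← mul_assoc, (this.pow_left k).eq]
    rw [hc]
    rcases k with _ | k
    · simp
    · simp only [Nat.add_sub_cancel, mul_smul_comm]
      rw [← mul_assoc ω (ω ^ k), ← pow_succ']
      push_cast
      module

theorem exp_ctr [CharZero K] [FiniteDimensional K V] (v : V)
    (ω : ExteriorAlgebra K (Module.Dual K V))
    (hω : ω ∈ (⋀[K]^2 (Module.Dual K V))) (b : Module.Dual K V)
    (hb : ctr v ω = ExteriorAlgebra.ι K b) (x : ExteriorAlgebra K (Module.Dual K V)) :
    ctr v (expA (K := K) (Module.finrank K V) ω * x) =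
      expA (K := K) (Module.finrank K V) ω * (ExteriorAlgebra.ι K b * x + ctr v x) := by
  have hz : ω ^ (finrank K V) * ExteriorAlgebra.ι K b = 0 := by
    have : Commute ω (ExteriorAlgebra.ι K b) := two_comm_ι ω hω b
    rw [(this.pow_left _).eq]
    refine deg_top (k := 2 * finrank K V + 1) (by omega) _ ?_
    rw [ep_succ]
    exact Submodule.mul_mem_mul ⟨b, rfl⟩ (two_pow_mem ω hω _)
  rw [mul_add]
  simp only [expA, Finset.sum_mul, map_sum, smul_mul_assoc, map_smul, pow_ctr v ω hω b hb,
    smul_add, Finset.sum_add_distrib]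
  congr 1
  rw [Finset.sum_range_succ', Finset.sum_range_succ]
  rw [← mul_assoc (ω ^ finrank K V), hz]
  simp only [Nat.cast_zero, zero_smul, smul_zero, zero_mul, Nat.add_sub_cancel]
  congr 1
  refine Finset.sum_congr rfl fun k _ => ?_
  rw [smul_smul, Nat.factorial_succ]
  congr 1
  have h1 : ((k : K) + 1) ≠ 0 := by exact_mod_cast Nat.succ_ne_zero k
  have h2 : (k.factorial : K) ≠ 0 := by exact_mod_cast Nat.factorial_ne_zero k
  push_cast
  field_simp

theorem exp_comm_ι [FiniteDimensional K V] (ω : ExteriorAlgebra K (Module.Dual K V))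
    (hω : ω ∈ (⋀[K]^2 (Module.Dual K V))) (c : Module.Dual K V) (n : ℕ) :
    ExteriorAlgebra.ι K c * expA (K := K) n ω = expA (K := K) n ω * ExteriorAlgebra.ι K c := by
  simp only [expA, Finset.sum_mul, Finset.mul_sum]
  refine Finset.sum_congr rfl fun k _ => ?_
  have : Commute ω (ExteriorAlgebra.ι K c) := two_comm_ι ω hω c
  rw [smul_mul_assoc, mul_smul_comm, (this.pow_left k).eq]

theorem exp_unit [FiniteDimensional K V] (ω : ExteriorAlgebra K (Module.Dual K V))
    (hω : ω ∈ (⋀[K]^2 (Module.Dual K V))) (n : ℕ) : IsUnit (expA (K := K) n ω) := by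
  have hn : IsNilpotent ω := ⟨finrank K V + 1, deg_top (k := 2 * (finrank K V + 1)) (by omega) _
    (two_pow_mem ω hω _)⟩
  rw [expA, Finset.sum_range_succ']
  simp only [pow_zero, Nat.factorial_zero, Nat.cast_one, inv_one, one_smul]
  apply IsNilpotent.isUnit_add_one
  have : ∑ k ∈ Finset.range n, ((k + 1).factorial : K)⁻¹ • ω ^ (k + 1) =
      ω * ∑ k ∈ Finset.range n, ((k + 1).factorial : K)⁻¹ • ω ^ k := by
    rw [Finset.mul_sum]
    refine Finset.sum_congr rfl fun k _ => ?_
    rw [mul_smul_comm, pow_succ']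
  rw [this]
  refine Commute.isNilpotent_mul_right ?_ hn
  refine Commute.sum_right _ _ _ fun k _ => ?_
  exact ((Commute.refl ω).pow_right k).smul_right _

theorem rho_exp [CharZero K] [FiniteDimensional K V] (w : V × Module.Dual K V)
    (ω : ExteriorAlgebra K (Module.Dual K V))
    (hω : ω ∈ (⋀[K]^2 (Module.Dual K V))) (b : Module.Dual K V)
    (hb : ctr w.1 ω = ExteriorAlgebra.ι K b) (x : ExteriorAlgebra K (Module.Dual K V)) :
    rhoL w (expA (K := K) (Module.finrank K V) ω * x) =
      expA (K := K) (Module.finrank K V) ω * rhoL (w.1, w.2 + b) x := by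
  rw [rhoL_apply, rhoL_apply, exp_ctr w.1 ω hω b hb, ← mul_assoc, exp_comm_ι ω hω, mul_assoc,
    ← mul_add]
  simp only [map_add, add_mul]
  congr 1
  abel

theorem pull_rho (Φ : V →ₗ[K] V') (v : V) (a : Module.Dual K V')
    (x : ExteriorAlgebra K (Module.Dual K V')) :
    rhoL (v, a.comp Φ) (extPullback Φ x) = extPullback Φ (rhoL (Φ v, a) x) := by
  rw [rhoL_apply, rhoL_apply, map_add, map_mul, pull_ι, pull_ctr]

/-- The backward image of a co-isotropic subspace is co-isotropic (no 2-form). -/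
theorem back_coiso [FiniteDimensional K V] [FiniteDimensional K V'] (Φ : V →ₗ[K] V')
    (F' : Submodule K (V' × Module.Dual K V'))
    (hF' : ∀ w', (∀ u' ∈ F', w'.2 u'.1 + u'.2 w'.1 = 0) → w' ∈ F')
    (v : V) (β : Module.Dual K V)
    (h : ∀ (u : V) (a : Module.Dual K V'), (Φ u, a) ∈ F' → β u + a (Φ v) = 0) :
    ∃ a : Module.Dual K V', (Φ v, a) ∈ F' ∧ a.comp Φ = β := by
  have hβ : β ∈ LinearMap.range Φ.dualMap := by
    rw [LinearMap.range_dualMap_eq_dualAnnihilator_ker, Submodule.mem_dualAnnihilator]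
    intro u hu
    have := h u 0 (by rw [LinearMap.mem_ker.1 hu]; exact F'.zero_mem)
    simpa using this
  obtain ⟨b, rfl⟩ := hβ
  let C : Submodule K (V' × Module.Dual K V') :=
    (LinearMap.ker Φ.dualMap).map (LinearMap.inr K V' (Module.Dual K V'))
  have hm : (Φ v, b) ∈ F' ⊔ C := by
    apply sep_lemma
    intro p hp
    have h1 : p ∈ F' := hF' p fun u hu => by
      rw [add_comm]; exact hp u (Submodule.mem_sup_left hu)
    have h2 : p.1 ∈ LinearMap.range Φ := by
      rw [← Subspace.dualAnnihilator_dualCoannihilator_eq (W := LinearMap.range Φ),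
        Submodule.mem_dualCoannihilator]
      intro c hc
      have hc' : c ∈ LinearMap.ker Φ.dualMap := by
        rw [LinearMap.ker_dualMap_eq_dualAnnihilator_range]; exact hc
      have := hp (0, c) (Submodule.mem_sup_right ⟨c, hc', rfl⟩)
      simpa using this
    obtain ⟨u, hu⟩ := h2
    have := h u p.2 (by rw [hu]; exact h1)
    rw [LinearMap.dualMap_apply, hu] at this
    exact this
  obtain ⟨f, hf, c, hc, hfc⟩ := Submodule.mem_sup.1 hm
  obtain ⟨c, hc, rfl⟩ := hc
  refine ⟨f.2, ?_, ?_⟩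
  · have : f.1 = Φ v := by simpa using congrArg Prod.fst hfc
    rw [← this]; exact hf
  · have : f.2 + c = b := by simpa using congrArg Prod.snd hfc
    have hc2 : c.comp Φ = 0 := hc
    rw [← this]
    change _ = (f.2 + c).comp Φ
    rw [LinearMap.add_comp, hc2, add_zero]

end helpers2

/-- let `(Φ, ω) : (V, E) → (V', E')` be a Dirac morphism of linear Dirac
spaces, `F'` a Lagrangian complement of `E'` defined by a pure spinor `ψ'`, `φ` a pure
spinor defining `E`, and `ψ = e^ω ∧ Φ*ψ'`. Then `ψ ≠ 0` and `ψ` is a pure spinor defining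
the backward image `F` of `F'`, and the following are equivalent: (a) `(Φ, ω)` is a strong
Dirac morphism; (b) `F` is transverse to `E`; (c) the top-degree pairing `(φᵀ ∧ ψ)^[top]`
is nonzero. -/
theorem pure_spinors_stmt16 {K V V' : Type*} [Field K] [CharZero K]
    [AddCommGroup V] [Module K V] [FiniteDimensional K V]
    [AddCommGroup V'] [Module K V'] [FiniteDimensional K V']
    (Φ : V →ₗ[K] V')
    (ω : ExteriorAlgebra K (Module.Dual K V)) (hω : ω ∈ (⋀[K]^2 (Module.Dual K V)))
    (φ : ExteriorAlgebra K (Module.Dual K V)) (hφ0 : φ ≠ 0)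
    (ψ' : ExteriorAlgebra K (Module.Dual K V')) (hψ'0 : ψ' ≠ 0)
    (E : Set (V × Module.Dual K V)) (E' F' : Set (V' × Module.Dual K V'))
    (hEφ : E = {w | cliffordRho w φ = 0})
    (hF'ψ : F' = {w' | cliffordRho w' ψ' = 0})
    (hElag : ∀ w, w ∈ E ↔ ∀ u ∈ E, w.2 u.1 + u.2 w.1 = 0)
    (hE'lag : ∀ w', w' ∈ E' ↔ ∀ u' ∈ E', w'.2 u'.1 + u'.2 w'.1 = 0)
    (hF'lag : ∀ w', w' ∈ F' ↔ ∀ u' ∈ F', w'.2 u'.1 + u'.2 w'.1 = 0)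
    -- `(Φ, ω)` is a Dirac morphism: `E'` is the forward image of `E`
    (hforward : ∀ w', w' ∈ E' ↔ ∃ w ∈ E, morphRelE Φ ω w w')
    -- `F'` is transverse to `E'`
    (htrans' : ∀ w', w' ∈ E' → w' ∈ F' → w' = 0)
    (ψ : ExteriorAlgebra K (Module.Dual K V))
    (hψ : ψ = expA (K := K) (Module.finrank K V) ω * extPullback Φ ψ')
    (F : Set (V × Module.Dual K V))
    (hF : F = {w | ∃ w' ∈ F', morphRelE Φ ω w w'}) :
    (ψ ≠ 0 ∧ F = {w | cliffordRho w ψ = 0}) ∧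
    ((∀ w : V × Module.Dual K V,
        w.1 ∈ LinearMap.ker Φ →
        ExteriorAlgebra.ι K w.2 +
            CliffordAlgebra.contractLeft (Module.Dual.eval K V w.1) ω = 0 →
        w ∈ E → w = 0) ↔
      (∀ w, w ∈ E → w ∈ F → w = 0)) ∧
    ((∀ w, w ∈ E → w ∈ F → w = 0) ↔
      GradedAlgebra.proj (fun i : ℕ => ⋀[K]^i (Module.Dual K V)) (Module.finrank K V)
          (revE φ * ψ) ≠ 0) := by
  have hinj : Function.Injective (ExteriorAlgebra.ι K : Module.Dual K V → _) :=
    (ExteriorAlgebra.ι_leftInverse (R := K) (M := Module.Dual K V)).injective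
  have hainj : Function.Injective (algebraMap K (ExteriorAlgebra K (Module.Dual K V))) :=
    (ExteriorAlgebra.algebraMap_leftInverse (R := K) (Module.Dual K V)).injective
  have hE : ∀ w, w ∈ E ↔ rhoL w φ = 0 := fun w => by rw [hEφ]; rfl
  have hF' : ∀ w', w' ∈ F' ↔ rhoL w' ψ' = 0 := fun w => by rw [hF'ψ]; rfl
  choose b hb using fun v => two_ctr_ι v ω hω
  have hrel : ∀ w w', morphRelE Φ ω w w' ↔ Φ w.1 = w'.1 ∧ w'.2.comp Φ = w.2 + b w.1 := by
    intro w w'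
    unfold morphRelE
    rw [ctr_def, hb, ← map_add, hinj.eq_iff]
  have hanti : ∀ v u, b v u = - b u v := by
    intro v u
    apply hainj
    rw [map_neg, ← ctr_ι, ← ctr_ι, ← hb, ← hb, ctr_comm]
  have hFm : ∀ w, w ∈ F ↔ ∃ a : Module.Dual K V', (Φ w.1, a) ∈ F' ∧ a.comp Φ = w.2 + b w.1 := by
    intro w
    rw [hF]
    constructor
    · rintro ⟨⟨v', a⟩, h1, h2⟩
      obtain ⟨h3, h4⟩ := (hrel _ _).1 h2
      exact ⟨a, by rw [h3]; exact h1, h4⟩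
    · rintro ⟨a, h1, h2⟩
      exact ⟨_, h1, (hrel _ _).2 ⟨rfl, h2⟩⟩
  have hrho : ∀ w, rhoL w ψ = expA (K := K) (Module.finrank K V) ω *
      rhoL (w.1, w.2 + b w.1) (extPullback Φ ψ') := fun w => by
    rw [hψ, rho_exp w ω hω _ (hb w.1)]
  -- the pulled-back spinor is nonzero
  have hpull : extPullback Φ ψ' ≠ 0 := by
    intro h0
    have hX : (LinearMap.range Φ).prod ⊤ ⊔ LinearMap.ker (rhoL.flip ψ') = ⊤ := by
      rw [eq_top_iff]
      intro w _
      apply sep_lemma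
      intro p hp
      have h1 : p.1 = 0 := by
        rw [← Module.forall_dual_apply_eq_zero_iff K]
        intro a
        have := hp (0, a) (Submodule.mem_sup_left ⟨Submodule.zero_mem _, trivial⟩)
        simpa using this
      have h2 : p.2.comp Φ = 0 := by
        ext v
        have := hp (Φ v, 0) (Submodule.mem_sup_left ⟨⟨v, rfl⟩, trivial⟩)
        simpa using this
      have h3 : p ∈ F' := (hF'lag p).2 fun u hu => by
        rw [add_comm]
        exact hp u (Submodule.mem_sup_right ((hF' u).1 hu))
      have h4 : p ∈ E' := (hforward p).2 ⟨0, (hE 0).2 (by simp), (hrel _ _).2 ⟨by simp [h1], by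
        rw [h2]
        have : b 0 = 0 := by
          apply hinj
          rw [← hb, map_zero]; simp [ctr]
        simp [this]⟩⟩
      rw [htrans' p h4 h3]; simp
    have hT := gen_lemma ψ' hψ'0 ((LinearMap.range Φ).prod ⊤ : Submodule K (V' × Module.Dual K V'))
      (fun w => by
        have hw : w ∈ (LinearMap.range Φ).prod ⊤ ⊔ LinearMap.ker (rhoL.flip ψ') := by
          rw [hX]; trivial
        obtain ⟨a, ha, f, hf, h⟩ := Submodule.mem_sup.1 hw
        exact ⟨a, ha, f, hf, h.symm⟩)
      (LinearMap.ker (extPullback Φ).toLinearMap) h0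
      (by
        rintro ⟨_, a⟩ ⟨⟨v, rfl⟩, _⟩ x hx
        have hx' : extPullback Φ x = 0 := hx
        change extPullback Φ (rhoL (Φ v, a) x) = 0
        rw [← pull_rho, hx', map_zero])
    have h1 : (1 : ExteriorAlgebra K (Module.Dual K V')) ∈
        LinearMap.ker (extPullback Φ).toLinearMap := by rw [hT]; trivial
    have h2 : extPullback Φ 1 = 0 := h1
    rw [map_one] at h2
    exact one_ne_zero h2
  have hu := exp_unit ω hω (Module.finrank K V)
  have hψ0 : ψ ≠ 0 := by
    rw [hψ]
    intro h
    exact hpull (hu.mul_right_eq_zero.1 h)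
  have hsub : ∀ w ∈ F, rhoL w ψ = 0 := by
    intro w hw
    obtain ⟨a, ha, h⟩ := (hFm w).1 hw
    rw [hrho, ← h, pull_rho, (hF' _).1 ha, map_zero, mul_zero]
  have hFco : ∀ w, (∀ u ∈ F, w.2 u.1 + u.2 w.1 = 0) → w ∈ F := by
    intro w hw
    rw [hFm]
    refine back_coiso Φ (LinearMap.ker (rhoL.flip ψ')) ?_ w.1 (w.2 + b w.1) ?_ |>.imp ?_
    · intro w' h
      exact (hF' _).1 ((hF'lag w').2 fun u hu => h u ((hF' u).1 hu))
    · intro u a ha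
      have := hw (u, a.comp Φ - b u) ((hFm _).2 ⟨a, (hF' _).2 ha, by simp⟩)
      simp only [LinearMap.sub_apply, LinearMap.comp_apply] at this
      rw [LinearMap.add_apply, hanti w.1 u, ← this]
      ring
    · rintro a ⟨h1, h2⟩
      exact ⟨(hF' _).2 h1, h2⟩
  have hiso : ∀ (x : ExteriorAlgebra K (Module.Dual K V)), x ≠ 0 → ∀ w u,
      rhoL w x = 0 → rhoL u x = 0 → w.2 u.1 + u.2 w.1 = 0 := by
    intro x hx w u hw hu'
    have := rhoL_comm w u x
    rw [hw, hu', map_zero, map_zero, sub_zero] at this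
    exact (smul_eq_zero.1 this.symm).resolve_right hx
  have hFψ : ∀ w, w ∈ F ↔ rhoL w ψ = 0 :=
    fun w => ⟨hsub w, fun h => hFco w fun u hu' => hiso ψ hψ0 w u h (hsub u hu')⟩
  refine ⟨⟨hψ0, Set.ext fun w => hFψ w⟩, ⟨?_, ?_⟩, ⟨?_, ?_⟩⟩
  · intro ha w hwE hwF
    rw [hF] at hwF
    obtain ⟨w', hw', hr⟩ := hwF
    have h0 := htrans' w' ((hforward w').2 ⟨w, hwE, hr⟩) hw'
    subst h0
    refine ha w hr.1 ?_ hwE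
    rw [← hr.2]
    simp
  · intro hbt w h1 h2 hwE
    refine hbt w hwE ?_
    rw [hF]
    refine ⟨0, (hF' 0).2 (by simp), by simpa using h1, ?_⟩
    rw [h2]
    simp
  · intro ht hB
    have hX : LinearMap.ker (rhoL.flip φ) ⊔ LinearMap.ker (rhoL.flip ψ) = ⊤ := by
      rw [eq_top_iff]
      intro w _
      apply sep_lemma
      intro p hp
      have h1 : p ∈ E := (hElag p).2 fun u hu' => by
        rw [add_comm]
        exact hp u (Submodule.mem_sup_left ((hE u).1 hu'))
      have h2 : p ∈ F := hFco p fun u hu' => by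
        rw [add_comm]
        exact hp u (Submodule.mem_sup_right ((hFψ u).1 hu'))
      rw [ht p h1 h2]; simp
    let B : ExteriorAlgebra K (Module.Dual K V) →ₗ[K] ExteriorAlgebra K (Module.Dual K V) →ₗ[K]
        ExteriorAlgebra K (Module.Dual K V) :=
      ((LinearMap.mul K (ExteriorAlgebra K (Module.Dual K V))).compr₂ (pr (finrank K V))).comp
        (CliffordAlgebra.reverse (Q := (0 : QuadraticForm K (Module.Dual K V))))
    have hBd : ∀ x y, B x y = pr (finrank K V) (revE x * y) := fun _ _ => rfl
    have hadj : ∀ w x y, B (rhoL w x) y = B x (rhoL w y) := fun w x y => by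
      rw [hBd, hBd, pair_adj]
    have hT := gen_lemma ψ hψ0 (LinearMap.ker (rhoL.flip φ) : Submodule K (V × Module.Dual K V))
      (fun w => by
        have hw : w ∈ LinearMap.ker (rhoL.flip φ) ⊔ LinearMap.ker (rhoL.flip ψ) := by
          rw [hX]; trivial
        obtain ⟨a, ha, f, hf, h⟩ := Submodule.mem_sup.1 hw
        exact ⟨a, ha, f, hf, h.symm⟩)
      (LinearMap.ker (B φ)) hB
      (by
        intro a ha x _
        have ha' : rhoL a φ = 0 := ha
        rw [LinearMap.mem_ker, ← hadj, ha', map_zero, LinearMap.zero_apply])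
    have hφB : φ ∈ LinearMap.ker B := LinearMap.ker_eq_top.1 hT
    have hR := irred (LinearMap.ker B) (by
      intro w x hx
      rw [LinearMap.mem_ker] at hx ⊢
      refine LinearMap.ext fun y => ?_
      rw [hadj, hx]
      rfl) φ hφB hφ0
    obtain ⟨t, ht'⟩ := exists_top (K := K) (V := V)
    apply ht'
    have h1 : (1 : ExteriorAlgebra K (Module.Dual K V)) ∈ LinearMap.ker B := by rw [hR]; trivial
    have h2 := LinearMap.congr_fun (LinearMap.mem_ker.1 h1) t
    have h3 : revE (1 : ExteriorAlgebra K (Module.Dual K V)) = 1 :=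
      CliffordAlgebra.reverse.map_one
    rw [hBd, h3, one_mul] at h2
    exact h2
  · intro hB w hwE hwF
    by_contra hw0
    apply hB
    change pr (finrank K V) (revE φ * ψ) = 0
    have hex : ∃ u : V × Module.Dual K V, w.2 u.1 + u.2 w.1 ≠ 0 := by
      by_contra! hc
      apply hw0
      refine Prod.ext ?_ ?_
      · rw [Prod.fst_zero, ← Module.forall_dual_apply_eq_zero_iff K]
        intro a
        simpa using hc (0, a)
      · ext v
        simpa using hc (v, 0)
    obtain ⟨u, hu'⟩ := hex
    have h1 := rhoL_comm w u ψ
    rw [(hFψ w).1 hwF, map_zero, sub_zero] at h1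
    have h2 := pair_adj w φ (rhoL u ψ)
    have h3 : revE (0 : ExteriorAlgebra K (Module.Dual K V)) = 0 := map_zero _
    rw [(hE w).1 hwE, h3, zero_mul, map_zero, h1, mul_smul_comm, map_smul] at h2
    exact (smul_eq_zero.1 h2.symm).resolve_left hu'
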